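/- Let J : ℝ → ℝ be a quadratic function J(z) = a + g·(z − μ) + (k/2)·(z − μ)², with a, g, μ, k ∈ ℝ. For σ ∈ ℝ, define F(σ) = E_{ε~N(0,1)}[J(μ + σ·ε)]. Then F is differentiable and F'(σ) = k·σ. In particular, if k > 0, the expected gradient of the objective with respect to σ is proportional to σ with positive proportionality constant, so σ = 0 is the unique stationary point of F and it is the global minimizer of F. -/

import Mathlib

open MeasureTheory ProbabilityTheory

/-- The second moment of a standard Gaussian is `1`. -/
lemma integral_sq_gaussianReal_zero_one : ∫ x, x ^ 2 ∂(gaussianReal 0 1) = 1 := by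
  have h := variance_fun_id_gaussianReal (μ := 0) (v := 1)
  rw [variance_of_integral_eq_zero aemeasurable_id' integral_id_gaussianReal] at h
  simpa using h

/-- The expectation of a quadratic polynomial under the standard Gaussian. -/
lemma integral_quadratic_gaussianReal_zero_one (a b c : ℝ) :
    ∫ x, (a + b * x + c * x ^ 2) ∂(gaussianReal 0 1) = a + c := by
  have h₁ : Integrable (fun x : ℝ ↦ x) (gaussianReal 0 1) :=
    (memLp_id_gaussianReal 1).integrable le_rfl
  have h₂ : Integrable (fun x : ℝ ↦ x ^ 2) (gaussianReal 0 1) :=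
    (memLp_id_gaussianReal 2).integrable_sq
  have h₃ : Integrable (fun x : ℝ ↦ a + b * x) (gaussianReal 0 1) :=
    (integrable_const a).add (h₁.const_mul b)
  rw [integral_add h₃ (h₂.const_mul c),
    integral_add (integrable_const a) (h₁.const_mul b), integral_const_mul, integral_const_mul,
    integral_id_gaussianReal, integral_sq_gaussianReal_zero_one]
  simp

/-- For the quadratic loss `J(z) = a + g·(z − μ) + (k/2)·(z − μ)²`
and `F(σ) = E_{ε~N(0,1)}[J(μ + σ·ε)]`, the function `F` is differentiable with
`F'(σ) = k·σ`; in particular, if `k > 0` then `σ = 0` is the unique stationary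
point of `F` and the global minimizer of `F`. -/
theorem expected_quadratic_loss_deriv (a g μ k : ℝ)
    (J : ℝ → ℝ) (hJ : ∀ z, J z = a + g * (z - μ) + (k / 2) * (z - μ) ^ 2)
    (F : ℝ → ℝ) (hF : ∀ σ, F σ = ∫ x, J (μ + σ * x) ∂(gaussianReal 0 1)) :
    (∀ σ, HasDerivAt F (k * σ) σ) ∧
      (0 < k → (∀ σ, deriv F σ = 0 ↔ σ = 0) ∧ ∀ σ, F 0 ≤ F σ) := by
  have hF' : F = fun σ ↦ a + k / 2 * σ ^ 2 := by
    funext σ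
    rw [hF, ← integral_quadratic_gaussianReal_zero_one a (g * σ) (k / 2 * σ ^ 2)]
    congr 1 with x
    rw [hJ]
    ring
  have hd : ∀ σ, HasDerivAt F (k * σ) σ := by
    intro σ
    rw [hF']
    refine (((hasDerivAt_pow 2 σ).const_mul (k / 2)).const_add a).congr_deriv ?_
    push_cast
    ring
  refine ⟨hd, fun hk ↦ ⟨fun σ ↦ ?_, fun σ ↦ ?_⟩⟩
  · rw [(hd σ).deriv, mul_eq_zero, or_iff_right hk.ne']
  · simp only [hF']
    nlinarith [mul_nonneg hk.le (sq_nonneg σ)]
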